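/- arXiv:2604.14211 — 3 statements merged into one kernel-verified Lean document; each statement's English description precedes it below -/
import Mathlib

section
/- Let (X,d) be an ε-geodesic Polish metric space endowed with a random walk m, and let k ∈ ℝ. If the Ollivier–Ricci curvature satisfies Ric(x,y) ≥ k for every pair of distinct points x,y ∈ X with d(x,y) ≤ ε, then Ric(x,y) ≥ k for every pair of distinct points x,y ∈ X. -/
open MeasureTheory

namespace ORC

variable {X : Type*} [MetricSpace X] [MeasurableSpace X]

/-- The 1-Wasserstein distance between two measures: the infimum over all couplings `π`
of `μ` and `ν` of `∫ d(x,y) dπ(x,y)`. -/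
noncomputable def W1 (μ ν : Measure X) : ℝ :=
  sInf {c | ∃ π : Measure (X × X), π.map Prod.fst = μ ∧ π.map Prod.snd = ν ∧
    c = ∫ p : X × X, dist p.1 p.2 ∂π}

/-- A random walk on `X`: a measurable family of probability measures with finite first
moment. -/
def IsRandomWalk (m : X → Measure X) : Prop :=
  Measurable m ∧ (∀ x, IsProbabilityMeasure (m x)) ∧
    ∀ x z, Integrable (fun y => dist z y) (m x)

/-- The Ollivier–Ricci curvature along `(x,y)`. -/
noncomputable def Ric (m : X → Measure X) (x y : X) : ℝ :=
  1 - W1 (m x) (m y) / dist x y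

/-- `(X,d)` is `ε`-geodesic: any two points are joined by a chain of points realizing the
distance, with consecutive points at distance at most `ε`. -/
def IsEpsGeodesic (X : Type*) [MetricSpace X] (ε : ℝ) : Prop :=
  ∀ x y : X, ∃ (n : ℕ) (s : ℕ → X), s 0 = x ∧ s n = y ∧
    dist x y = ∑ i ∈ Finset.range n, dist (s i) (s (i + 1)) ∧
    ∀ i < n, dist (s i) (s (i + 1)) ≤ ε

open ProbabilityTheory

variable {μ ν ρ : Measure X}

theorem bddBelow_couplingCosts (μ ν : Measure X) :
    BddBelow {c | ∃ π : Measure (X × X), π.map Prod.fst = μ ∧ π.map Prod.snd = ν ∧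
      c = ∫ p : X × X, dist p.1 p.2 ∂π} :=
  ⟨0, by rintro _ ⟨π, -, -, rfl⟩; exact integral_nonneg fun _ => dist_nonneg⟩

theorem W1_le_of_coupling {π : Measure (X × X)} (h₁ : π.map Prod.fst = μ)
    (h₂ : π.map Prod.snd = ν) : W1 μ ν ≤ ∫ p : X × X, dist p.1 p.2 ∂π :=
  csInf_le (bddBelow_couplingCosts μ ν) ⟨π, h₁, h₂, rfl⟩

theorem exists_coupling_lt [IsProbabilityMeasure μ] [IsProbabilityMeasure ν] {c : ℝ}
    (hc : W1 μ ν < c) : ∃ π : Measure (X × X), π.map Prod.fst = μ ∧ π.map Prod.snd = ν ∧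
      ∫ p : X × X, dist p.1 p.2 ∂π < c := by
  have hne : {c | ∃ π : Measure (X × X), π.map Prod.fst = μ ∧ π.map Prod.snd = ν ∧
      c = ∫ p : X × X, dist p.1 p.2 ∂π}.Nonempty := ⟨_, μ.prod ν, by simp, by simp, rfl⟩
  obtain ⟨_, ⟨π, h₁, h₂, rfl⟩, hlt⟩ := exists_lt_of_csInf_lt hne hc
  exact ⟨π, h₁, h₂, hlt⟩

theorem le_Ric_iff {m : X → Measure X} {x y : X} {k : ℝ} (hxy : x ≠ y) :
    k ≤ Ric m x y ↔ W1 (m x) (m y) ≤ (1 - k) * dist x y := by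
  rw [Ric, le_sub_comm, div_le_iff₀ (dist_pos.2 hxy)]

variable [PolishSpace X] [BorelSpace X]

theorem W1_self_nonpos (μ : Measure X) : W1 μ μ ≤ 0 := by
  have hdiag : Measurable fun x : X => (x, x) := by fun_prop
  have h := W1_le_of_coupling (π := μ.map fun x => (x, x)) (μ := μ) (ν := μ)
    (by rw [Measure.map_map measurable_fst hdiag]; exact Measure.map_id)
    (by rw [Measure.map_map measurable_snd hdiag]; exact Measure.map_id)
  rwa [integral_map hdiag.aemeasurable (by fun_prop), show
    (fun x : X => dist (x, x).1 (x, x).2) = fun _ => (0 : ℝ) from funext fun x => dist_self x,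
    integral_zero] at h

theorem integrable_dist_of_coupling {π : Measure (X × X)} {z : X}
    (h₁ : π.map Prod.fst = μ) (h₂ : π.map Prod.snd = ν)
    (hμ : Integrable (fun y => dist z y) μ) (hν : Integrable (fun y => dist z y) ν) :
    Integrable (fun p : X × X => dist p.1 p.2) π := by
  subst h₁ h₂
  refine ((hμ.comp_measurable measurable_fst).add (hν.comp_measurable measurable_snd)).mono'
    (by fun_prop) (ae_of_all _ fun p => ?_)
  simpa using dist_triangle_left p.1 p.2 z

/-- The gluing lemma: two couplings with a common marginal come from a measure on the triple
product. -/
theorem exists_glued_measure {X : Type*} [MeasurableSpace X] [StandardBorelSpace X] [Nonempty X]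
    {π σ : Measure (X × X)} [IsFiniteMeasure π] [IsFiniteMeasure σ]
    (h : π.map Prod.snd = σ.map Prod.fst) :
    ∃ τ : Measure ((X × X) × X), τ.map Prod.fst = π ∧ τ.map (fun q => (q.1.2, q.2)) = σ := by
  let κ : Kernel (X × X) X := σ.condKernel.comap (Prod.snd : X × X → X) measurable_snd
  refine ⟨π ⊗ₘ κ, Measure.fst_compProd π κ, ?_⟩
  have hσ : (π.map Prod.snd) ⊗ₘ σ.condKernel = σ := by
    rw [h]; exact σ.disintegrate σ.condKernel
  conv_rhs => rw [← hσ]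
  ext s hs
  rw [Measure.map_apply (by fun_prop) hs, Measure.compProd_apply (by measurability),
    Measure.compProd_apply hs, lintegral_map (Kernel.measurable_kernel_prodMk_left hs)
      measurable_snd]
  rfl

theorem W1_triangle [IsProbabilityMeasure μ] [IsProbabilityMeasure ν] [IsProbabilityMeasure ρ]
    {z : X} (hμ : Integrable (fun y => dist z y) μ) (hν : Integrable (fun y => dist z y) ν)
    (hρ : Integrable (fun y => dist z y) ρ) : W1 μ ρ ≤ W1 μ ν + W1 ν ρ := by
  have : Nonempty X := ⟨z⟩
  refine le_of_forall_pos_le_add fun δ hδ => ?_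
  obtain ⟨π, hπ₁, hπ₂, hπ⟩ := exists_coupling_lt (lt_add_of_pos_right (W1 μ ν) (half_pos hδ))
  obtain ⟨σ, hσ₁, hσ₂, hσ⟩ := exists_coupling_lt (lt_add_of_pos_right (W1 ν ρ) (half_pos hδ))
  have iπ := integrable_dist_of_coupling hπ₁ hπ₂ hμ hν
  have iσ := integrable_dist_of_coupling hσ₁ hσ₂ hν hρ
  have : IsProbabilityMeasure (π.map Prod.fst) := hπ₁ ▸ inferInstance
  have : IsProbabilityMeasure (σ.map Prod.fst) := hσ₁ ▸ inferInstance
  have : IsProbabilityMeasure π := Measure.isProbabilityMeasure_of_map Prod.fst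
  have : IsProbabilityMeasure σ := Measure.isProbabilityMeasure_of_map Prod.fst
  obtain ⟨τ, hτ₁, hτ₂⟩ := exists_glued_measure (hπ₂.trans hσ₁.symm)
  have m₁ : Measurable (Prod.fst : (X × X) × X → X × X) := measurable_fst
  have m₂ : Measurable fun q : (X × X) × X => (q.1.2, q.2) := by fun_prop
  have m₃ : Measurable fun q : (X × X) × X => (q.1.1, q.2) := by fun_prop
  have h₁ : (τ.map fun q => (q.1.1, q.2)).map Prod.fst = μ := by
    rw [← hπ₁, ← hτ₁, Measure.map_map measurable_fst m₃, Measure.map_map measurable_fst m₁]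
    rfl
  have h₂ : (τ.map fun q => (q.1.1, q.2)).map Prod.snd = ρ := by
    rw [← hσ₂, ← hτ₂, Measure.map_map measurable_snd m₃, Measure.map_map measurable_snd m₂]
    rfl
  have i₃ := integrable_dist_of_coupling h₁ h₂ hμ hρ
  have hle := W1_le_of_coupling h₁ h₂
  rw [integral_map m₃.aemeasurable (by fun_prop)] at hle
  rw [← hτ₁] at iπ hπ
  rw [← hτ₂] at iσ hσ
  rw [integral_map m₁.aemeasurable (by fun_prop)] at hπ
  rw [integral_map m₂.aemeasurable (by fun_prop)] at hσ
  have key : ∫ q, dist q.1.1 q.2 ∂τ ≤ ∫ q, dist q.1.1 q.1.2 ∂τ + ∫ q, dist q.1.2 q.2 ∂τ := by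
    refine le_of_le_of_eq ?_ (integral_add (iπ.comp_measurable m₁) (iσ.comp_measurable m₂))
    exact integral_mono (i₃.comp_measurable m₃)
      ((iπ.comp_measurable m₁).add (iσ.comp_measurable m₂)) fun q => dist_triangle _ _ _
  linarith

end ORC

open ORC

/-- If `(X,d)` is an `ε`-geodesic Polish metric space endowed with a random walk `m` and
`Ric(x,y) ≥ k` for all distinct `x,y` with `d(x,y) ≤ ε`, then `Ric(x,y) ≥ k` for all
distinct `x,y`. -/
theorem olivier_ricci_eps_geodesic {X : Type*} [MetricSpace X] [PolishSpace X]
    [MeasurableSpace X] [BorelSpace X]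
    (ε : ℝ) (hε : 0 < ε) (hgeo : IsEpsGeodesic X ε)
    (m : X → Measure X) (hm : IsRandomWalk m) (k : ℝ)
    (hk : ∀ x y : X, x ≠ y → dist x y ≤ ε → k ≤ Ric m x y) :
    ∀ x y : X, x ≠ y → k ≤ Ric m x y := by
  intro x y hxy
  obtain ⟨-, hprob, hint⟩ := hm
  have hstep (a b : X) (hab : dist a b ≤ ε) : W1 (m a) (m b) ≤ (1 - k) * dist a b := by
    obtain rfl | hne := eq_or_ne a b
    · simpa using W1_self_nonpos (m a)
    · exact (le_Ric_iff hne).1 (hk a b hne hab)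
  obtain ⟨n, s, rfl, rfl, hsum, hs⟩ := hgeo x y
  have hchain : ∀ j ≤ n, W1 (m (s 0)) (m (s j)) ≤
      (1 - k) * ∑ i ∈ Finset.range j, dist (s i) (s (i + 1)) := by
    intro j
    induction j with
    | zero => intro _; simpa using W1_self_nonpos (m (s 0))
    | succ j ih =>
      intro hj
      rw [Finset.sum_range_succ, mul_add]
      exact (W1_triangle (hint _ (s 0)) (hint _ _) (hint _ _)).trans
        (add_le_add (ih (by lia)) (hstep _ _ (hs j hj)))
  rw [le_Ric_iff hxy, hsum]
  exact hchain n le_rfl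
end

section
/- Let (X,d) be a Polish metric space endowed with a random walk m and let k ∈ ℝ. Then Ric(x,y) ≥ k for all distinct x,y ∈ X if and only if for any two probability measures μ, μ′ on X with finite first moment one has W1(μ * m, μ′ * m) ≤ (1 − k) · W1(μ, μ′). Moreover, in this case, if μ has finite first moment then μ * m has finite first moment. -/
open MeasureTheory

namespace ORC

variable {X : Type*} [MetricSpace X] [MeasurableSpace X]

/-- A measure has finite first moment if `∫ d(o,x) dμ(x) < ∞`. -/
def FiniteFirstMoment (μ : Measure X) : Prop :=
  ∀ o : X, Integrable (fun x => dist o x) μ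

end ORC

open ORC

namespace ORC

open Set Filter Topology ProbabilityTheory
open scoped ENNReal NNReal

/-- The couplings of two measures. -/
def couplings {X : Type*} [MeasurableSpace X] (μ ν : Measure X) : Set (Measure (X × X)) :=
  {π | π.map Prod.fst = μ ∧ π.map Prod.snd = ν}

/-- The 1-Wasserstein distance with values in `[0, ∞]`. -/
noncomputable def eW1 {X : Type*} [MetricSpace X] [MeasurableSpace X] (μ ν : Measure X) : ℝ≥0∞ :=
  ⨅ π ∈ couplings μ ν, ∫⁻ p, edist p.1 p.2 ∂π

section

variable {X : Type*} [MeasurableSpace X] {μ ν ρ : Measure X}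

lemma isProbabilityMeasure_of_mem_couplings {π : Measure (X × X)} [IsProbabilityMeasure μ]
    (h : π ∈ couplings μ ν) : IsProbabilityMeasure π := by
  refine ⟨?_⟩
  have := congrArg (fun τ : Measure X => τ univ) h.1
  simpa [Measure.map_apply measurable_fst MeasurableSet.univ] using this

lemma lintegral_fst {π : Measure (X × X)} (h : π ∈ couplings μ ν) {f : X → ℝ≥0∞}
    (hf : Measurable f) : ∫⁻ p, f p.1 ∂π = ∫⁻ x, f x ∂μ := by
  rw [← h.1, lintegral_map hf measurable_fst]

lemma lintegral_snd {π : Measure (X × X)} (h : π ∈ couplings μ ν) {f : X → ℝ≥0∞}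
    (hf : Measurable f) : ∫⁻ p, f p.2 ∂π = ∫⁻ x, f x ∂ν := by
  rw [← h.2, lintegral_map hf measurable_snd]

lemma isProbabilityMeasure_bind {m : X → Measure X} (hm : Measurable m)
    [∀ x, IsProbabilityMeasure (m x)] [IsProbabilityMeasure μ] :
    IsProbabilityMeasure (μ.bind m) :=
  ⟨by simp [Measure.bind_apply MeasurableSet.univ hm.aemeasurable]⟩

lemma exists_gluing [StandardBorelSpace X] [Nonempty X] [IsProbabilityMeasure ν]
    {π₁ π₂ : Measure (X × X)} (h₁ : π₁ ∈ couplings ν μ) (h₂ : π₂ ∈ couplings ν ρ) :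
    ∃ Γ : Measure (X × X × X), Γ.map (fun p => (p.1, p.2.1)) = π₁ ∧
      Γ.map (fun p => (p.1, p.2.2)) = π₂ := by
  have := isProbabilityMeasure_of_mem_couplings h₁
  have := isProbabilityMeasure_of_mem_couplings h₂
  refine ⟨ν ⊗ₘ (π₁.condKernel ×ₖ π₂.condKernel), ?_, ?_⟩
  · have := Measure.compProd_map (μ := ν) (κ := π₁.condKernel ×ₖ π₂.condKernel) measurable_fst
    rw [← Kernel.fst_eq, Kernel.fst_prod] at this
    have e : ν = π₁.fst := h₁.1.symm
    conv_rhs => rw [← π₁.disintegrate π₁.condKernel, ← e, this]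
    rfl
  · have := Measure.compProd_map (μ := ν) (κ := π₁.condKernel ×ₖ π₂.condKernel) measurable_snd
    rw [← Kernel.snd_eq, Kernel.snd_prod] at this
    have e : ν = π₂.fst := h₂.1.symm
    conv_rhs => rw [← π₂.disintegrate π₂.condKernel, ← e, this]
    rfl

lemma map_simpleFunc_eq_sum (T : SimpleFunc X X) (μ : Measure X) :
    μ.map T = ∑ b ∈ T.range, μ (T ⁻¹' {b}) • Measure.dirac b := by
  classical
  ext s hs
  rw [Measure.map_apply T.measurable hs, Measure.finsetSum_apply]
  simp only [Measure.smul_apply, smul_eq_mul, Measure.dirac_apply' _ hs]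
  have : T ⁻¹' s = T ⁻¹' (T.range.filter (· ∈ s) : Finset X) := by
    ext x; simp
  rw [this, ← T.sum_measure_preimage_singleton, Finset.sum_filter]
  refine Finset.sum_congr rfl fun b _ => ?_
  by_cases hb : b ∈ s <;> simp [hb]

lemma exists_measurable_discretization {Y : Type*} [PseudoMetricSpace Y]
    [SecondCountableTopology Y] [MeasurableSpace Y] [OpensMeasurableSpace Y] [Nonempty X]
    {φ : X → Y} (hφ : Measurable φ) {ε : ℝ} (hε : 0 < ε) :
    ∃ (u : ℕ → X) (ι : X → ℕ), Measurable ι ∧ ∀ x, dist (φ x) (φ (u (ι x))) < ε := by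
  classical
  have hd := TopologicalSpace.denseRange_denseSeq (range φ)
  choose u hu using fun n => (TopologicalSpace.denseSeq (range φ) n).2
  have hex (x : X) : ∃ n, dist (φ x) (φ (u n)) < ε := by
    obtain ⟨n, hn⟩ := Metric.denseRange_iff.1 hd ⟨φ x, mem_range_self x⟩ ε hε
    exact ⟨n, by rw [hu]; exact hn⟩
  refine ⟨u, fun x => Nat.find (hex x), measurable_find hex fun n => ?_,
    fun x => Nat.find_spec (hex x)⟩
  exact measurableSet_lt (hφ.dist measurable_const) measurable_const

end

section

variable {X : Type*} [MetricSpace X] [MeasurableSpace X] {μ ν ρ : Measure X}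

lemma eW1_le {π : Measure (X × X)} (h : π ∈ couplings μ ν) :
    eW1 μ ν ≤ ∫⁻ p, edist p.1 p.2 ∂π :=
  iInf₂_le π h

lemma exists_coupling_of_eW1_lt {c : ℝ≥0∞} (h : eW1 μ ν < c) :
    ∃ π ∈ couplings μ ν, ∫⁻ p, edist p.1 p.2 ∂π < c := by
  simpa [eW1, iInf_lt_iff] using h

lemma lintegral_edist_ne_top (hμ : FiniteFirstMoment μ) (o : X) :
    ∫⁻ x, edist o x ∂μ ≠ ∞ := by
  have := (hμ o).2
  rw [hasFiniteIntegral_iff_norm] at this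
  simpa [edist_dist] using this.ne

variable [BorelSpace X]

lemma lintegral_edist_le_add_eW1 (o : X) :
    ∫⁻ x, edist o x ∂ν ≤ ∫⁻ x, edist o x ∂μ + eW1 μ ν := by
  have hf : Measurable fun x : X => edist o x := by fun_prop
  rw [eW1, ENNReal.add_iInf₂]
  refine le_iInf₂ fun π h => ?_
  rw [← lintegral_fst h hf, ← lintegral_snd h hf, ← lintegral_add_left (by fun_prop)]
  exact lintegral_mono fun p => edist_triangle _ _ _

lemma lintegral_edist_le_of_mem_couplings {π : Measure (X × X)} (h : π ∈ couplings μ ν) (o : X) :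
    ∫⁻ p, edist p.1 p.2 ∂π ≤ ∫⁻ x, edist o x ∂μ + ∫⁻ x, edist o x ∂ν := by
  have hf : Measurable fun x : X => edist o x := by fun_prop
  rw [← lintegral_fst h hf, ← lintegral_snd h hf, ← lintegral_add_left (by fun_prop)]
  exact lintegral_mono fun p => edist_triangle_left _ _ _

variable [SecondCountableTopology X]

lemma finiteFirstMoment_of_lintegral_ne_top
    (h : ∀ o : X, ∫⁻ x, edist o x ∂μ ≠ ∞) : FiniteFirstMoment μ := by
  intro o
  refine ⟨(by fun_prop : Measurable fun x : X => dist o x).aestronglyMeasurable, ?_⟩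
  rw [hasFiniteIntegral_iff_norm, lt_top_iff_ne_top]
  simpa [edist_dist] using h o

lemma eW1_comm_le : eW1 μ ν ≤ eW1 ν μ := by
  refine le_iInf₂ fun π h => ?_
  refine (eW1_le (π := π.map Prod.swap) ⟨?_, ?_⟩).trans_eq ?_
  · rw [Measure.map_map measurable_fst measurable_swap]; exact h.2
  · rw [Measure.map_map measurable_snd measurable_swap]; exact h.1
  · rw [lintegral_map (by fun_prop) measurable_swap]
    simp [edist_comm]

lemma eW1_comm : eW1 μ ν = eW1 ν μ := le_antisymm eW1_comm_le eW1_comm_le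

lemma W1_eq_toReal_eW1 (o : X) (hμ : FiniteFirstMoment μ) (hν : FiniteFirstMoment ν) :
    W1 μ ν = (eW1 μ ν).toReal := by
  rw [eW1, ← sInf_image, ENNReal.toReal_sInf, W1]
  · congr 1
    ext c
    have key (π : Measure (X × X)) :
        (∫⁻ p, edist p.1 p.2 ∂π).toReal = ∫ p, dist p.1 p.2 ∂π := by
      rw [integral_eq_lintegral_of_nonneg_ae (ae_of_all _ fun p => dist_nonneg)
        (by fun_prop : Measurable fun p : X × X => dist p.1 p.2).aestronglyMeasurable]
      simp [edist_dist]
    simp only [mem_ofPred_eq, mem_image, exists_exists_and_eq_and, key, couplings]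
    exact ⟨fun ⟨π, h1, h2, h3⟩ => ⟨π, ⟨h1, h2⟩, h3.symm⟩,
      fun ⟨π, ⟨h1, h2⟩, h3⟩ => ⟨π, h1, h2, h3.symm⟩⟩
  · rintro _ ⟨π, h, rfl⟩
    exact ne_top_of_le_ne_top (ENNReal.add_ne_top.2
      ⟨lintegral_edist_ne_top hμ o, lintegral_edist_ne_top hν o⟩)
      (lintegral_edist_le_of_mem_couplings h o)

lemma eW1_ne_top [IsProbabilityMeasure μ] [IsProbabilityMeasure ν] (o : X)
    (hμ : FiniteFirstMoment μ) (hν : FiniteFirstMoment ν) : eW1 μ ν ≠ ∞ := by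
  have h : μ.prod ν ∈ couplings μ ν := ⟨by simp, by simp⟩
  exact ne_top_of_le_ne_top (ENNReal.add_ne_top.2
      ⟨lintegral_edist_ne_top hμ o, lintegral_edist_ne_top hν o⟩)
      ((eW1_le h).trans (lintegral_edist_le_of_mem_couplings h o))

lemma eW1_self : eW1 μ μ = 0 := by
  have hd : Measurable fun x : X => (x, x) := by fun_prop
  refine le_antisymm ((eW1_le (π := μ.map fun x => (x, x)) ⟨?_, ?_⟩).trans_eq ?_) zero_le
  · rw [Measure.map_map measurable_fst hd]; exact Measure.map_id
  · rw [Measure.map_map measurable_snd hd]; exact Measure.map_id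
  · rw [lintegral_map (by fun_prop) hd]; simp

lemma eW1_dirac (x y : X) : eW1 (Measure.dirac x) (Measure.dirac y) = edist x y := by
  apply le_antisymm
  · refine (eW1_le (π := Measure.dirac (x, y)) ⟨?_, ?_⟩).trans_eq ?_
    · exact Measure.map_dirac' measurable_fst _
    · exact Measure.map_dirac' measurable_snd _
    · rw [lintegral_dirac' _ (by fun_prop)]
  · simpa using lintegral_edist_le_add_eW1 (μ := Measure.dirac x) (ν := Measure.dirac y) x

lemma eW1_map_le {T : X → X} (hT : Measurable T) :
    eW1 μ (μ.map T) ≤ ∫⁻ y, edist (T y) y ∂μ := by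
  have hd : Measurable fun x : X => (x, T x) := by fun_prop
  refine (eW1_le (π := μ.map fun x => (x, T x)) ⟨?_, ?_⟩).trans_eq ?_
  · rw [Measure.map_map measurable_fst hd]; exact Measure.map_id
  · rw [Measure.map_map measurable_snd hd]; rfl
  · rw [lintegral_map (by fun_prop) hd]; simp [edist_comm]

/-- Two measures with a common part `ρ` are coupled by keeping `ρ` in place and coupling the
remainders independently. -/
lemma eW1_add_le {r s : Measure X} [IsFiniteMeasure r] [IsFiniteMeasure s]
    (hrs : r univ = s univ) (o : X) :
    eW1 (ρ + r) (ρ + s) ≤ ∫⁻ x, edist o x ∂r + ∫⁻ x, edist o x ∂s := by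
  have hd : Measurable fun x : X => (x, x) := by fun_prop
  have hf : Measurable fun x : X => edist o x := by fun_prop
  have hc : r univ ≠ ∞ := measure_ne_top _ _
  have cancel (τ : Measure X) (hτ : τ univ = r univ) : (r univ)⁻¹ • r univ • τ = τ := by
    by_cases h0 : r univ = 0
    · rw [h0, Measure.measure_univ_eq_zero] at hτ
      simp [hτ]
    · rw [smul_smul, ENNReal.inv_mul_cancel h0 hc, one_smul]
  have h1 : (((r univ)⁻¹ • r.prod s).map Prod.fst) = r := by
    rw [Measure.map_smul, ← Measure.fst, Measure.fst, Measure.map_fst_prod, ← hrs, cancel r rfl]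
  have h2 : (((r univ)⁻¹ • r.prod s).map Prod.snd) = s := by
    rw [Measure.map_smul, Measure.map_snd_prod, cancel s hrs.symm]
  refine (eW1_le (π := ρ.map (fun x => (x, x)) + (r univ)⁻¹ • r.prod s) ⟨?_, ?_⟩).trans ?_
  · rw [Measure.map_add _ _ measurable_fst, h1, Measure.map_map measurable_fst hd]
    exact congrArg (· + r) Measure.map_id
  · rw [Measure.map_add _ _ measurable_snd, h2, Measure.map_map measurable_snd hd]
    exact congrArg (· + s) Measure.map_id
  · rw [lintegral_add_measure, lintegral_map (by fun_prop) hd]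
    simpa using lintegral_edist_le_of_mem_couplings ⟨h1, h2⟩ o

lemma eW1_triangle [StandardBorelSpace X] [IsProbabilityMeasure ν] :
    eW1 μ ρ ≤ eW1 μ ν + eW1 ν ρ := by
  have : Nonempty X := nonempty_of_isProbabilityMeasure ν
  rw [eW1_comm (μ := μ) (ν := ν)]
  refine ENNReal.le_iInf₂_add_iInf₂ fun π₁ h₁ π₂ h₂ => ?_
  obtain ⟨Γ, rfl, rfl⟩ := exists_gluing h₁ h₂
  have hm₁ : Measurable fun p : X × X × X => (p.1, p.2.1) := by fun_prop
  have hm₂ : Measurable fun p : X × X × X => (p.1, p.2.2) := by fun_prop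
  have e₁ := h₁.2
  have e₂ := h₂.2
  rw [Measure.map_map measurable_snd hm₁] at e₁
  rw [Measure.map_map measurable_snd hm₂] at e₂
  refine (eW1_le (π := Γ.map Prod.snd) ⟨?_, ?_⟩).trans ?_
  · rwa [Measure.map_map measurable_fst measurable_snd]
  · rwa [Measure.map_map measurable_snd measurable_snd]
  · rw [lintegral_map (by fun_prop) measurable_snd, lintegral_map (by fun_prop) hm₁,
      lintegral_map (by fun_prop) hm₂, ← lintegral_add_left (by fun_prop)]
    exact lintegral_mono fun p => edist_triangle_left _ _ _

lemma eW1_map_simpleFunc_le [IsProbabilityMeasure μ] [IsProbabilityMeasure ν]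
    (T : SimpleFunc X X) {η D : ℝ≥0∞} {o : X} (hD : ∀ b ∈ T.range, edist o b ≤ D)
    (h₁ : ∀ b ∈ T.range, μ (T ⁻¹' {b}) ≤ ν (T ⁻¹' {b}) + η)
    (h₂ : ∀ b ∈ T.range, ν (T ⁻¹' {b}) ≤ μ (T ⁻¹' {b}) + η) :
    eW1 (μ.map T) (ν.map T) ≤ 2 * (T.range.card * (η * D)) := by
  let rem (μ ν : Measure X) : Measure X :=
    ∑ b ∈ T.range, (μ (T ⁻¹' {b}) - min (μ (T ⁻¹' {b})) (ν (T ⁻¹' {b}))) • Measure.dirac b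
  let com : Measure X :=
    ∑ b ∈ T.range, min (μ (T ⁻¹' {b})) (ν (T ⁻¹' {b})) • Measure.dirac b
  have hμ : μ.map T = com + rem μ ν := by
    rw [map_simpleFunc_eq_sum, ← Finset.sum_add_distrib]
    refine Finset.sum_congr rfl fun b _ => ?_
    rw [← add_smul, add_tsub_cancel_of_le (min_le_left _ _)]
  have hν : ν.map T = com + rem ν μ := by
    rw [map_simpleFunc_eq_sum, ← Finset.sum_add_distrib]
    refine Finset.sum_congr rfl fun b _ => ?_
    rw [← add_smul, min_comm, add_tsub_cancel_of_le (min_le_left _ _)]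
  have := Measure.isProbabilityMeasure_map (μ := μ) T.measurable.aemeasurable
  have := Measure.isProbabilityMeasure_map (μ := ν) T.measurable.aemeasurable
  have hlμ : rem μ ν ≤ μ.map T := hμ ▸ Measure.le_add_left le_rfl
  have hlν : rem ν μ ≤ ν.map T := hν ▸ Measure.le_add_left le_rfl
  have hlc : com ≤ μ.map T := hμ ▸ Measure.le_add_right le_rfl
  have := isFiniteMeasure_of_le _ hlμ
  have := isFiniteMeasure_of_le _ hlν
  have := isFiniteMeasure_of_le _ hlc
  have hmass : rem μ ν univ = rem ν μ univ := by
    have h1 : (com + rem μ ν) univ = (com + rem ν μ) univ := by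
      rw [← hμ, ← hν, measure_univ, measure_univ]
    rw [Measure.add_apply, Measure.add_apply] at h1
    exact (ENNReal.add_right_inj (measure_ne_top com univ)).1 h1
  have key (μ ν : Measure X) (h : ∀ b ∈ T.range, μ (T ⁻¹' {b}) ≤ ν (T ⁻¹' {b}) + η) :
      ∫⁻ x, edist o x ∂(rem μ ν) ≤ T.range.card * (η * D) := by
    rw [lintegral_finsetSum_measure, ← nsmul_eq_mul]
    refine Finset.sum_le_card_nsmul _ _ _ fun b hb => ?_
    rw [lintegral_smul_measure, lintegral_dirac' _ (by fun_prop), smul_eq_mul]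
    refine mul_le_mul' ?_ (hD b hb)
    rw [tsub_le_iff_left]
    rcases le_total (μ (T ⁻¹' {b})) (ν (T ⁻¹' {b})) with hle | hle
    · simp [hle]
    · simpa [hle] using h b hb
  rw [hμ, hν, two_mul]
  exact (eW1_add_le hmass o).trans (add_le_add (key μ ν h₁) (key ν μ h₂))

lemma exists_simpleFunc_lintegral_edist_lt (hμ : FiniteFirstMoment μ) (hν : FiniteFirstMoment ν)
    (o : X) {ε : ℝ≥0∞} (hε : 0 < ε) :
    ∃ T : SimpleFunc X X, ∫⁻ y, edist (T y) y ∂μ < ε ∧ ∫⁻ y, edist (T y) y ∂ν < ε ∧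
      ∀ y, edist (T y) y ≤ edist o y := by
  let T (n : ℕ) : SimpleFunc X X :=
    SimpleFunc.approxOn id measurable_id univ o (mem_univ o) n
  have hT (n : ℕ) (y : X) : edist (T n y) y ≤ edist o y :=
    SimpleFunc.edist_approxOn_le measurable_id (mem_univ o) y n
  have key (μ : Measure X) (hμ : FiniteFirstMoment μ) :
      Tendsto (fun n => ∫⁻ y, edist (T n y) y ∂μ) atTop (𝓝 0) := by
    have := tendsto_lintegral_of_dominated_convergence (μ := μ)
      (F := fun n y => edist (T n y) y) (f := fun _ => 0) (fun y => edist o y)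
      (fun n => (T n).measurable.edist measurable_id)
      (fun n => ae_of_all _ (hT n)) (lintegral_edist_ne_top hμ o) (ae_of_all _ fun y => ?_)
    · simpa using this
    · rw [← tendsto_iff_edist_tendsto_0]
      exact SimpleFunc.tendsto_approxOn measurable_id (mem_univ o) (by simp)
  obtain ⟨n, h₁, h₂⟩ := (((key μ hμ).eventually_lt_const hε).and
    ((key ν hν).eventually_lt_const hε)).exists
  exact ⟨T n, h₁, h₂, hT n⟩

lemma le_add_of_dist_toReal_lt {a b : ℝ≥0∞} {η : ℝ≥0} (ha : a ≠ ∞) (hb : b ≠ ∞)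
    (h : dist a.toReal b.toReal < η) : a ≤ b + η := by
  lift a to ℝ≥0 using ha
  lift b to ℝ≥0 using hb
  rw [Real.dist_eq] at h
  have := (abs_lt.1 h).2
  simp only [ENNReal.coe_toReal] at this
  norm_cast
  rw [← NNReal.coe_le_coe]
  push_cast
  linarith

lemma eW1_bind_comp_le [StandardBorelSpace X] {m : X → Measure X} (hm : Measurable m)
    [∀ x, IsProbabilityMeasure (m x)] [IsProbabilityMeasure μ] {S : X → X} (hS : Measurable S)
    (T : SimpleFunc X X) {η D δ : ℝ≥0∞} {o : X} (hD : ∀ b ∈ T.range, edist o b ≤ D)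
    (h₁ : ∀ x, ∀ b ∈ T.range, m x (T ⁻¹' {b}) ≤ m (S x) (T ⁻¹' {b}) + η)
    (h₂ : ∀ x, ∀ b ∈ T.range, m (S x) (T ⁻¹' {b}) ≤ m x (T ⁻¹' {b}) + η)
    (h₃ : ∀ x, ∫⁻ y, edist (T y) y ∂(m (S x)) ≤ ∫⁻ y, edist (T y) y ∂(m x) + δ) :
    eW1 (μ.bind m) (μ.bind (m ∘ S)) ≤
      2 * ∫⁻ y, edist (T y) y ∂(μ.bind m) + δ + 2 * (T.range.card * (η * D)) := by
  have hmS : Measurable (m ∘ S) := hm.comp hS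
  have : ∀ x, IsProbabilityMeasure ((m ∘ S) x) := fun x =>
    inferInstanceAs (IsProbabilityMeasure (m (S x)))
  have := isProbabilityMeasure_bind (μ := μ) hm
  have := isProbabilityMeasure_bind (μ := μ) hmS
  have := Measure.isProbabilityMeasure_map (μ := μ.bind m) T.measurable.aemeasurable
  have := Measure.isProbabilityMeasure_map (μ := μ.bind (m ∘ S)) T.measurable.aemeasurable
  have hTm : Measurable fun y => edist (T y) y := T.measurable.edist measurable_id
  have integrate {f g : X → Measure X} (hf : Measurable f) (hg : Measurable g) (b : X)
      (h : ∀ x, f x (T ⁻¹' {b}) ≤ g x (T ⁻¹' {b}) + η) :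
      μ.bind f (T ⁻¹' {b}) ≤ μ.bind g (T ⁻¹' {b}) + η := by
    rw [Measure.bind_apply (T.measurableSet_fiber b) hf.aemeasurable,
      Measure.bind_apply (T.measurableSet_fiber b) hg.aemeasurable]
    refine (lintegral_mono h).trans_eq ?_
    rw [lintegral_add_right _ measurable_const]
    simp
  have e₁ := eW1_map_le (μ := μ.bind m) T.measurable
  have e₂ := eW1_map_simpleFunc_le (μ := μ.bind m) (ν := μ.bind (m ∘ S)) T hD
    (fun b hb => integrate hm hmS b fun x => h₁ x b hb)
    (fun b hb => integrate hmS hm b fun x => h₂ x b hb)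
  have e₃ := eW1_map_le (μ := μ.bind (m ∘ S)) T.measurable
  have e₄ : ∫⁻ y, edist (T y) y ∂(μ.bind (m ∘ S)) ≤ ∫⁻ y, edist (T y) y ∂(μ.bind m) + δ := by
    rw [Measure.lintegral_bind hmS.aemeasurable hTm.aemeasurable,
      Measure.lintegral_bind hm.aemeasurable hTm.aemeasurable]
    refine (lintegral_mono h₃).trans_eq ?_
    rw [lintegral_add_right _ measurable_const]
    simp
  rw [eW1_comm] at e₃
  calc eW1 (μ.bind m) (μ.bind (m ∘ S))
      ≤ eW1 (μ.bind m) ((μ.bind m).map T) +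
        (eW1 ((μ.bind m).map T) ((μ.bind (m ∘ S)).map T) +
          eW1 ((μ.bind (m ∘ S)).map T) (μ.bind (m ∘ S))) :=
        eW1_triangle.trans (by gcongr; exact eW1_triangle)
    _ ≤ ∫⁻ y, edist (T y) y ∂(μ.bind m) + (2 * (T.range.card * (η * D)) +
          (∫⁻ y, edist (T y) y ∂(μ.bind m) + δ)) := by
        gcongr
        exact e₃.trans e₄
    _ = _ := by ring

/-- A random walk can be replaced, up to a small Wasserstein error, by one depending only on a
countable measurable discretization of the starting point. -/
lemma exists_discretization_eW1_bind_le [StandardBorelSpace X] [Nonempty X] {m : X → Measure X}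
    (hm : IsRandomWalk m) [IsProbabilityMeasure μ] [IsProbabilityMeasure ν]
    (hμ : FiniteFirstMoment (μ.bind m)) (hν : FiniteFirstMoment (ν.bind m))
    {ε : ℝ≥0} (hε : 0 < ε) :
    ∃ (u : ℕ → X) (ι : X → ℕ), Measurable ι ∧ (∀ x, edist x (u (ι x)) ≤ ε) ∧
      eW1 (μ.bind m) (μ.bind fun x => m (u (ι x))) ≤ 4 * ε ∧
      eW1 (ν.bind m) (ν.bind fun x => m (u (ι x))) ≤ 4 * ε := by
  obtain ⟨hmm, hmp, hmi⟩ := hm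
  obtain ⟨o⟩ := ‹Nonempty X›
  have : Nonempty X := ⟨o⟩
  obtain ⟨T, hTμ, hTν, hTo⟩ := exists_simpleFunc_lintegral_edist_lt hμ hν o
    (ENNReal.coe_pos.2 hε)
  let D : ℝ≥0 := T.range.sup fun b => nndist o b
  have hD : ∀ b ∈ T.range, edist o b ≤ D := fun b hb => by
    rw [edist_nndist, ENNReal.coe_le_coe]
    exact Finset.le_sup (f := fun b => nndist o b) hb
  let c : ℝ≥0 := 2 * (T.range.card * D) + 1
  have hc : 1 ≤ c := le_add_of_nonneg_left zero_le
  let η : ℝ≥0 := ε / c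
  have hη : 0 < η := div_pos hε (zero_lt_one.trans_le hc)
  have hηε : η ≤ ε := div_le_self zero_le hc
  have hηc : 2 * (T.range.card * (η * D)) ≤ ε := by
    calc 2 * (T.range.card * (η * D)) = η * (2 * (T.range.card * D)) := by ring
      _ ≤ η * c := by gcongr; exact le_add_of_nonneg_right zero_le
      _ = ε := div_mul_cancel₀ _ (zero_lt_one.trans_le hc).ne'
  have hTm : Measurable fun y => edist (T y) y := T.measurable.edist measurable_id
  let φ (x : X) : X × ℝ × (T.range → ℝ) :=
    (x, (∫⁻ y, edist (T y) y ∂(m x)).toReal, fun b => (m x (T ⁻¹' {b.1})).toReal)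
  have hφ : Measurable φ := by
    refine measurable_id.prodMk (Measurable.prodMk ?_ (measurable_pi_lambda _ fun b => ?_))
    · exact ((Measure.measurable_lintegral hTm).comp hmm).ennreal_toReal
    · exact ((Measure.measurable_coe (T.measurableSet_fiber b.1)).comp hmm).ennreal_toReal
  obtain ⟨u, ι, hι, hu⟩ := exists_measurable_discretization hφ (NNReal.coe_pos.2 hη)
  have hfin (x : X) : ∫⁻ y, edist (T y) y ∂(m x) ≠ ∞ :=
    ne_top_of_le_ne_top (lintegral_edist_ne_top (hmi x) o) (lintegral_mono hTo)
  have hux (x : X) : dist x (u (ι x)) < η := (le_max_left _ _).trans_lt (hu x)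
  have hu₂ (x : X) := (le_max_right _ _).trans_lt (hu x)
  have hue (x : X) := (le_max_left _ _).trans_lt (hu₂ x)
  have hub (x : X) (b : X) (hb : b ∈ T.range) :=
    (dist_le_pi_dist _ _ ⟨b, hb⟩).trans_lt ((le_max_right _ _).trans_lt (hu₂ x))
  have main (μ : Measure X) [IsProbabilityMeasure μ]
      (hTμ : ∫⁻ y, edist (T y) y ∂(μ.bind m) < ε) :
      eW1 (μ.bind m) (μ.bind fun x => m (u (ι x))) ≤ 4 * ε := by
    refine (eW1_bind_comp_le (δ := η) (η := η) (S := fun x => u (ι x)) hmm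
      (measurable_from_top.comp hι) T hD
      (fun x b hb => le_add_of_dist_toReal_lt (measure_ne_top _ _) (measure_ne_top _ _)
        (hub x b hb))
      (fun x b hb => le_add_of_dist_toReal_lt (measure_ne_top _ _) (measure_ne_top _ _)
        (by rw [dist_comm]; exact hub x b hb))
      (fun x => le_add_of_dist_toReal_lt (hfin _) (hfin _)
        (by rw [dist_comm]; exact hue x))).trans ?_
    calc _ ≤ 2 * (ε : ℝ≥0∞) + ε + ε := by
          gcongr
          exact_mod_cast hηc
      _ = 4 * ε := by ring
  refine ⟨u, ι, hι, fun x => ?_, main μ hTμ, main ν hTν⟩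
  rw [edist_nndist, ENNReal.coe_le_coe, ← NNReal.coe_le_coe, coe_nndist]
  exact (hux x).le.trans (NNReal.coe_le_coe.2 hηε)

/-- If a random walk is `K`-Lipschitz on points for the Wasserstein distance, then walks started
from coupled points and depending only on a countable discretization can be coupled. -/
lemma eW1_bind_discretization_le {m : X → Measure X} {K : ℝ≥0}
    (hK : ∀ x y, eW1 (m x) (m y) ≤ K * edist x y) {u : ℕ → X} {ι : X → ℕ} (hι : Measurable ι)
    {ε : ℝ≥0} (hε : 0 < ε) (hu : ∀ x, edist x (u (ι x)) ≤ ε) [IsProbabilityMeasure μ]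
    {π : Measure (X × X)} (hπ : π ∈ couplings μ ν) :
    eW1 (μ.bind fun x => m (u (ι x))) (ν.bind fun x => m (u (ι x))) ≤
      K * (∫⁻ p, edist p.1 p.2 ∂π + 2 * ε) + ε := by
  have := isProbabilityMeasure_of_mem_couplings hπ
  have hlt (i j : ℕ) : eW1 (m (u i)) (m (u j)) < K * edist (u i) (u j) + ε :=
    (hK _ _).trans_lt (ENNReal.lt_add_right (ENNReal.mul_ne_top ENNReal.coe_ne_top
      (edist_ne_top _ _)) (ENNReal.coe_pos.2 hε).ne')
  choose Q hQ hQc using fun i j => exists_coupling_of_eW1_lt (hlt i j)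
  have hq : Measurable fun p : X × X => Q (ι p.1) (ι p.2) :=
    (Measurable.of_discrete (f := fun q : ℕ × ℕ => Q q.1 q.2)).comp
      ((hι.comp measurable_fst).prodMk (hι.comp measurable_snd))
  have hmι : Measurable fun x => m (u (ι x)) :=
    (measurable_from_top (f := fun n => m (u n))).comp hι
  have map_bind {f : X × X → X} (hf : Measurable f) :
      (π.bind fun p => Q (ι p.1) (ι p.2)).map f =
        π.bind fun p => (Q (ι p.1) (ι p.2)).map f := by
    have hqf : Measurable fun p : X × X => (Q (ι p.1) (ι p.2)).map f :=
      (Measure.measurable_map f hf).comp hq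
    ext s hs
    rw [Measure.map_apply hf hs, Measure.bind_apply (hf hs) hq.aemeasurable,
      Measure.bind_apply hs hqf.aemeasurable]
    simp only [Measure.map_apply hf hs]
  have bind_map {f : X × X → X} (hf : Measurable f) :
      (π.map f).bind (fun x => m (u (ι x))) = π.bind fun p => m (u (ι (f p))) := by
    rw [Measure.bind, Measure.bind, Measure.map_map hmι hf]
    rfl
  refine (eW1_le (π := π.bind fun p => Q (ι p.1) (ι p.2)) ⟨?_, ?_⟩).trans ?_
  · rw [map_bind measurable_fst, ← hπ.1, bind_map measurable_fst]
    simp only [(hQ _ _).1]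
  · rw [map_bind measurable_snd, ← hπ.2, bind_map measurable_snd]
    simp only [(hQ _ _).2]
  · have hd : Measurable fun p : X × X => edist p.1 p.2 := by fun_prop
    rw [Measure.lintegral_bind hq.aemeasurable hd.aemeasurable]
    calc ∫⁻ p, ∫⁻ z, edist z.1 z.2 ∂(Q (ι p.1) (ι p.2)) ∂π
        ≤ ∫⁻ p, (K * (edist p.1 p.2 + 2 * ε) + ε) ∂π := by
          refine lintegral_mono fun p => (hQc _ _).le.trans ?_
          gcongr
          calc edist (u (ι p.1)) (u (ι p.2))
              ≤ edist (u (ι p.1)) p.1 + edist p.1 p.2 + edist p.2 (u (ι p.2)) :=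
                edist_triangle4 _ _ _ _
            _ ≤ ε + edist p.1 p.2 + ε := by
                gcongr
                · rw [edist_comm]; exact hu _
                · exact hu _
            _ = edist p.1 p.2 + 2 * ε := by ring
      _ = K * (∫⁻ p, edist p.1 p.2 ∂π + 2 * ε) + ε := by
          rw [lintegral_add_right _ measurable_const, lintegral_const_mul _ (by fun_prop),
            lintegral_add_right _ measurable_const]
          simp

theorem eW1_bind_le [StandardBorelSpace X] {m : X → Measure X} (hm : IsRandomWalk m) {K : ℝ≥0}
    (hK : ∀ x y, eW1 (m x) (m y) ≤ K * edist x y)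
    [IsProbabilityMeasure μ] [IsProbabilityMeasure ν]
    (hμ : FiniteFirstMoment (μ.bind m)) (hν : FiniteFirstMoment (ν.bind m)) :
    eW1 (μ.bind m) (ν.bind m) ≤ K * eW1 μ ν := by
  have : Nonempty X := nonempty_of_isProbabilityMeasure μ
  have hmp := hm.2.1
  have hprob (π : Measure (X × X)) (hπ : π ∈ couplings μ ν) :
      eW1 (μ.bind m) (ν.bind m) ≤ K * ∫⁻ p, edist p.1 p.2 ∂π := by
    refine ENNReal.le_of_forall_pos_le_add fun δ hδ _ => ?_
    let ε : ℝ≥0 := δ / (2 * K + 9)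
    have hε : 0 < ε := div_pos hδ (by positivity)
    have hεδ : (2 * K + 9) * ε = δ := mul_div_cancel₀ _ (by positivity)
    obtain ⟨u, ι, hι, hu, h₁, h₂⟩ := exists_discretization_eW1_bind_le hm hμ hν hε
    have hmι : Measurable fun x => m (u (ι x)) :=
      (measurable_from_top (f := fun n => m (u n))).comp hι
    have := isProbabilityMeasure_bind (μ := μ) hmι
    have := isProbabilityMeasure_bind (μ := ν) hmι
    rw [eW1_comm] at h₂
    calc eW1 (μ.bind m) (ν.bind m)
        ≤ eW1 (μ.bind m) (μ.bind fun x => m (u (ι x))) +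
          (eW1 (μ.bind fun x => m (u (ι x))) (ν.bind fun x => m (u (ι x))) +
            eW1 (ν.bind fun x => m (u (ι x))) (ν.bind m)) :=
          eW1_triangle.trans (by gcongr; exact eW1_triangle)
      _ ≤ 4 * ε + ((K * (∫⁻ p, edist p.1 p.2 ∂π + 2 * ε) + ε) + 4 * ε) := by
          gcongr
          exact eW1_bind_discretization_le hK hι hε hu hπ
      _ = K * ∫⁻ p, edist p.1 p.2 ∂π + ((2 * K + 9) * ε : ℝ≥0) := by
          push_cast; ring
      _ = K * ∫⁻ p, edist p.1 p.2 ∂π + δ := by rw [hεδ]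
  rcases eq_or_ne K 0 with rfl | hK0
  · obtain ⟨π, hπ⟩ : (couplings μ ν).Nonempty := ⟨μ.prod ν, by simp, by simp⟩
    simpa using hprob π hπ
  · simp_rw [eW1, ENNReal.mul_iInf_of_ne (ENNReal.coe_ne_zero.2 hK0) ENNReal.coe_ne_top]
    exact le_iInf₂ hprob

lemma finiteFirstMoment_bind {m : X → Measure X} (hm : IsRandomWalk m) {K : ℝ≥0}
    (hK : ∀ x y, eW1 (m x) (m y) ≤ K * edist x y) [IsProbabilityMeasure μ]
    (hμ : FiniteFirstMoment μ) : FiniteFirstMoment (μ.bind m) := by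
  refine finiteFirstMoment_of_lintegral_ne_top fun o => ?_
  have hf : Measurable fun x : X => edist o x := by fun_prop
  rw [Measure.lintegral_bind hm.1.aemeasurable hf.aemeasurable]
  have hle : ∫⁻ x, ∫⁻ y, edist o y ∂(m x) ∂μ ≤
      ∫⁻ x, (∫⁻ y, edist o y ∂(m o) + K * edist o x) ∂μ :=
    lintegral_mono fun x => (lintegral_edist_le_add_eW1 o).trans (by gcongr; exact hK o x)
  refine ne_top_of_le_ne_top ?_ hle
  rw [lintegral_add_left measurable_const, lintegral_const_mul _ hf, lintegral_const,
    measure_univ, mul_one]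
  exact ENNReal.add_ne_top.2 ⟨lintegral_edist_ne_top (hm.2.2 o) o,
    ENNReal.mul_ne_top ENNReal.coe_ne_top (lintegral_edist_ne_top hμ o)⟩

lemma finiteFirstMoment_dirac (x : X) : FiniteFirstMoment (Measure.dirac x) :=
  finiteFirstMoment_of_lintegral_ne_top fun o => by
    rw [lintegral_dirac' _ (by fun_prop)]
    exact edist_ne_top _ _

lemma eW1_le_of_le_ric {m : X → Measure X} (hm : IsRandomWalk m) {k : ℝ}
    (h : ∀ x y : X, x ≠ y → k ≤ Ric m x y) (x y : X) :
    eW1 (m x) (m y) ≤ (1 - k).toNNReal * edist x y := by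
  have hmp := hm.2.1
  rcases eq_or_ne x y with rfl | hxy
  · simp [eW1_self]
  · have hd := dist_pos.2 hxy
    have h1 := h x y hxy
    rw [Ric, W1_eq_toReal_eW1 x (hm.2.2 x) (hm.2.2 y), le_sub_comm, div_le_iff₀ hd] at h1
    rw [edist_dist, ← ENNReal.ofReal, ← ENNReal.ofReal_mul' hd.le]
    exact (ENNReal.le_ofReal_iff_toReal_le (eW1_ne_top x (hm.2.2 x) (hm.2.2 y))
      (ENNReal.toReal_nonneg.trans h1)).2 h1

end

end ORC

/-- `Ric(x,y) ≥ k` for all distinct `x,y` iff the random walk is `(1-k)`-contracting in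
`W1` on probability measures with finite first moment; moreover in this case the image
`μ * m = μ.bind m` of a measure with finite first moment again has finite first moment. -/
theorem olivier_ricci_W1_contraction {X : Type*} [MetricSpace X] [PolishSpace X]
    [MeasurableSpace X] [BorelSpace X]
    (m : X → Measure X) (hm : IsRandomWalk m) (k : ℝ) :
    ((∀ x y : X, x ≠ y → k ≤ Ric m x y) ↔
      (∀ μ μ' : Measure X, IsProbabilityMeasure μ → IsProbabilityMeasure μ' →
        FiniteFirstMoment μ → FiniteFirstMoment μ' →
        W1 (μ.bind m) (μ'.bind m) ≤ (1 - k) * W1 μ μ')) ∧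
    ((∀ x y : X, x ≠ y → k ≤ Ric m x y) →
      ∀ μ : Measure X, IsProbabilityMeasure μ → FiniteFirstMoment μ →
        FiniteFirstMoment (μ.bind m)) := by
  have hmp := hm.2.1
  refine ⟨⟨fun h μ μ' _ _ hμ hμ' => ?_, fun h x y hxy => ?_⟩, fun h μ _ hμ =>
    finiteFirstMoment_bind hm (eW1_le_of_le_ric hm h) hμ⟩
  · obtain ⟨o⟩ : Nonempty X := nonempty_of_isProbabilityMeasure μ
    have hK := eW1_le_of_le_ric hm h
    have hb := finiteFirstMoment_bind hm hK hμ
    have hb' := finiteFirstMoment_bind hm hK hμ'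
    have hle := eW1_bind_le hm hK hb hb'
    rw [W1_eq_toReal_eW1 o hb hb', W1_eq_toReal_eW1 o hμ hμ']
    have hle' := ENNReal.toReal_mono
      (ENNReal.mul_ne_top ENNReal.coe_ne_top (eW1_ne_top o hμ hμ')) hle
    rw [ENNReal.toReal_mul, ENNReal.coe_toReal] at hle'
    rcases le_or_gt 0 (1 - k) with hk | hk
    · rwa [Real.coe_toNNReal _ hk] at hle'
    · have hsub : Subsingleton X := by
        refine ⟨fun x y => by_contra fun hxy => ?_⟩
        have h1 := h x y hxy
        rw [Ric, W1_eq_toReal_eW1 x (hm.2.2 x) (hm.2.2 y)] at h1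
        have : 0 ≤ (eW1 (m x) (m y)).toReal / dist x y := by positivity
        linarith
      have h0 : eW1 μ μ' = 0 := by
        have : μ = μ' := by
          ext s _
          rcases s.eq_empty_or_nonempty with rfl | hs
          · simp
          · simp [Subsingleton.eq_univ_of_nonempty hs]
        rw [this, eW1_self]
      rw [h0] at hle' ⊢
      simpa using hle'
  · have h1 := h (Measure.dirac x) (Measure.dirac y) inferInstance inferInstance
      (finiteFirstMoment_dirac x) (finiteFirstMoment_dirac y)
    rw [Measure.dirac_bind hm.1, Measure.dirac_bind hm.1,
      W1_eq_toReal_eW1 (μ := Measure.dirac x) x (finiteFirstMoment_dirac x)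
        (finiteFirstMoment_dirac y), eW1_dirac, ← dist_edist] at h1
    rw [Ric, le_sub_comm, div_le_iff₀ (dist_pos.2 hxy)]
    exact h1
end

section
/- Let (X,d) be a Polish metric space endowed with a random walk m, and suppose Ric(x,y) ≥ k > 0 for all distinct x,y ∈ X. Then for any x,y ∈ X one has d(x,y) ≤ (J(x) + J(y)) / Ric(x,y), where J(x) = W1(δ_x, m_x) is the jump of the random walk at x. -/
open MeasureTheory

namespace ORC

variable {X : Type*} [MetricSpace X] [MeasurableSpace X]

/-- The jump of the random walk at `x`: `J(x) = W1(δ_x, m_x)`. -/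
noncomputable def J (m : X → Measure X) (x : X) : ℝ :=
  W1 (Measure.dirac x) (m x)

end ORC

open ORC

namespace ORC

section

variable {X : Type*} [MetricSpace X] [MeasurableSpace X]

theorem W1_nonneg (μ ν : Measure X) : 0 ≤ W1 μ ν := by
  refine Real.sInf_nonneg ?_
  rintro c ⟨π, -, -, rfl⟩
  exact integral_nonneg fun p => dist_nonneg

/-- A lower bound for the cost of every coupling is a lower bound for `W1`. -/
theorem le_W1 {μ ν : Measure X} [IsProbabilityMeasure μ] [IsProbabilityMeasure ν] {a : ℝ}
    (h : ∀ π : Measure (X × X), π.map Prod.fst = μ → π.map Prod.snd = ν →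
      a ≤ ∫ p : X × X, dist p.1 p.2 ∂π) : a ≤ W1 μ ν := by
  refine le_csInf ⟨_, μ.prod ν, ?_, ?_, rfl⟩ ?_
  · simp [Measure.map_fst_prod]
  · simp [Measure.map_snd_prod]
  · rintro c ⟨π, h1, h2, rfl⟩
    exact h π h1 h2

variable [SecondCountableTopology X] [BorelSpace X]

theorem integral_dist_le_W1_dirac (x : X) (ν : Measure X) [IsProbabilityMeasure ν] :
    ∫ z, dist x z ∂ν ≤ W1 (Measure.dirac x) ν := by
  refine le_W1 fun π h1 h2 => le_of_eq ?_
  have hfst : ∀ᵐ p ∂π, p.1 = x := by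
    refine ae_of_ae_map (f := Prod.fst) (p := fun z => z = x) measurable_fst.aemeasurable ?_
    rw [h1]
    exact (ae_dirac_iff (measurableSet_singleton x)).2 rfl
  rw [← h2, integral_map measurable_snd.aemeasurable
    (by fun_prop : Continuous fun z => dist x z).aestronglyMeasurable]
  refine integral_congr_ae ?_
  filter_upwards [hfst] with p hp
  simp [hp]

theorem dist_le_integral_dist_add_W1 {μ ν : Measure X} [IsProbabilityMeasure μ]
    [IsProbabilityMeasure ν] (x y : X) (hμ : Integrable (fun z => dist x z) μ)
    (hν : Integrable (fun z => dist y z) ν) :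
    dist x y ≤ ∫ z, dist x z ∂μ + ∫ z, dist y z ∂ν + W1 μ ν := by
  rw [← sub_le_iff_le_add']
  refine le_W1 fun π h1 h2 => ?_
  have : IsProbabilityMeasure (π.map Prod.fst) := by rw [h1]; infer_instance
  have : IsProbabilityMeasure π := Measure.isProbabilityMeasure_of_map Prod.fst
  subst h1 h2
  have i1 : Integrable (fun p : X × X => dist x p.1) π := hμ.comp_measurable measurable_fst
  have i2 : Integrable (fun p : X × X => dist y p.2) π := hν.comp_measurable measurable_snd
  have i3 : Integrable (fun p : X × X => dist p.1 p.2) π := by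
    refine ((i1.add i2).add (integrable_const (dist x y))).mono'
      continuous_dist.aestronglyMeasurable (.of_forall fun p => ?_)
    have := dist_triangle4 p.1 x y p.2
    rw [dist_comm p.1 x] at this
    simp only [Pi.add_apply, Real.norm_eq_abs, abs_of_nonneg dist_nonneg]
    linarith
  rw [integral_map measurable_fst.aemeasurable hμ.aestronglyMeasurable,
    integral_map measurable_snd.aemeasurable hν.aestronglyMeasurable,
    ← integral_add i1 i2, sub_le_iff_le_add', ← integral_add (by exact i1.add i2) i3]
  calc dist x y = ∫ _ : X × X, dist x y ∂π := by simp
    _ ≤ _ := by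
      refine integral_mono (integrable_const _) ((i1.add i2).add i3) fun p => ?_
      have := dist_triangle4 x p.1 p.2 y
      rw [dist_comm p.2 y] at this
      dsimp only
      linarith

end

end ORC

/-- `L¹` Bonnet–Myers, pointwise form: if `Ric(x,y) ≥ k > 0` for all distinct `x,y`, then
`d(x,y) ≤ (J(x) + J(y)) / Ric(x,y)` for all `x,y`. -/
theorem olivier_ricci_L1_bonnet_myers {X : Type*} [MetricSpace X] [PolishSpace X]
    [MeasurableSpace X] [BorelSpace X]
    (m : X → Measure X) (hm : IsRandomWalk m) (k : ℝ) (hk : 0 < k)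
    (hric : ∀ x y : X, x ≠ y → k ≤ Ric m x y) :
    ∀ x y : X, dist x y ≤ (J m x + J m y) / Ric m x y := by
  obtain ⟨-, hprob, hint⟩ := hm
  intro x y
  rcases eq_or_ne x y with rfl | hxy
  · have hJ : 0 ≤ J m x := W1_nonneg _ _
    simp only [Ric, dist_self, div_zero, sub_zero, div_one]
    linarith
  · have hd : 0 < dist x y := dist_pos.2 hxy
    have := hprob x
    have := hprob y
    have h := dist_le_integral_dist_add_W1 x y (hint x x) (hint y y)
    have hx : _ ≤ J m x := integral_dist_le_W1_dirac x (m x)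
    have hy : _ ≤ J m y := integral_dist_le_W1_dirac y (m y)
    rw [le_div_iff₀ (hk.trans_le (hric x y hxy)), Ric, mul_sub, mul_one,
      mul_div_cancel₀ _ hd.ne']
    linarith
end
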